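/- Define a : [0,∞) → ℝ by a(1) = 1 and a(t) = (1 + t − 2e^{t−1})/(1 − t) for t ≠ 1. Then a is continuous and positive on [0,∞) and ∫₀^∞ dt/a(t) < ∞. Moreover, y₀(t) = t·e^{−t} is a solution of (a(t)y')' + y = 0 on [0,∞), it satisfies ∫₁^∞ dt/(a(t)·y₀(t)²) = ∞ (so y₀ is a principal solution), and, since y₀(t) > 0 for all t ∈ (0,∞), the equation (a(t)y')' + y = 0 is disconjugate on [0,∞). -/

import Mathlib

open Set Filter MeasureTheory Topology Real

/-- `x` (with derivative `x'`) is a solution of `(a(t) x')' + c(t) F(x) = 0` on `I`: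
`x` is `C¹` on `I`, `t ↦ a t * x' t` is `C¹` on `I`, and the equation holds on `I`. -/
def SolODE (a c F : ℝ → ℝ) (I : Set ℝ) (x x' : ℝ → ℝ) : Prop :=
  (∀ t ∈ I, HasDerivWithinAt x (x' t) I t) ∧ ContinuousOn x' I ∧
  ∃ w : ℝ → ℝ, (∀ t ∈ I, HasDerivWithinAt (fun s => a s * x' s) (w t) I t) ∧
    ContinuousOn w I ∧ ∀ t ∈ I, w t + c t * F (x t) = 0

/-- `z` (with derivatives `z'`, `z''`) is a `C²` solution of `z'' + c(t) F(z) = 0` on `I`. -/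
def SolODE2 (c F : ℝ → ℝ) (I : Set ℝ) (z z' z'' : ℝ → ℝ) : Prop :=
  (∀ t ∈ I, HasDerivWithinAt z (z' t) I t) ∧ (∀ t ∈ I, HasDerivWithinAt z' (z'' t) I t) ∧
  ContinuousOn z'' I ∧ ∀ t ∈ I, z'' t + c t * F (z t) = 0

/-- The linear equation `(a(t) y')' + β(t) y = 0` is disconjugate on `I`:
every nontrivial solution has at most one zero in `I`. -/
def Disconjugate (a β : ℝ → ℝ) (I : Set ℝ) : Prop :=
  ∀ y y' : ℝ → ℝ, SolODE a β id I y y' → (∃ t ∈ I, y t ≠ 0) →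
    ∀ t₁ ∈ I, ∀ t₂ ∈ I, y t₁ = 0 → y t₂ = 0 → t₁ = t₂

/-- The linear equation `v'' + β(t) v = 0` is disconjugate on `I`:
every nontrivial solution has at most one zero in `I`. -/
def Disconjugate2 (β : ℝ → ℝ) (I : Set ℝ) : Prop :=
  ∀ v v' v'' : ℝ → ℝ, SolODE2 β id I v v' v'' → (∃ t ∈ I, v t ≠ 0) →
    ∀ t₁ ∈ I, ∀ t₂ ∈ I, v t₁ = 0 → v t₂ = 0 → t₁ = t₂

/-- The coefficient of Example 1. -/
noncomputable def aEx (t : ℝ) : ℝ :=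
  if t = 1 then 1 else (1 + t - 2 * Real.exp (t - 1)) / (1 - t)

lemma aEx_of_ne {t : ℝ} (ht : t ≠ 1) :
    aEx t = (1 + t - 2 * Real.exp (t - 1)) / (1 - t) := if_neg ht

lemma aEx_one : aEx 1 = 1 := if_pos rfl

lemma aEx_mul_one_sub (t : ℝ) : aEx t * (1 - t) = 1 + t - 2 * Real.exp (t - 1) := by
  rcases eq_or_ne t 1 with rfl | ht
  · norm_num
  · rw [aEx_of_ne ht, div_mul_cancel₀ _ (sub_ne_zero.mpr ht.symm)]

lemma hasDerivAt_aEx_numerator (t : ℝ) :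
    HasDerivAt (fun s => 1 + s - 2 * Real.exp (s - 1)) (1 - 2 * Real.exp (t - 1)) t := by
  have h := ((hasDerivAt_id t).sub_const 1).exp.const_mul 2
  simpa using ((hasDerivAt_id t).const_add 1).fun_sub h

lemma aEx_eq_neg_dslope :
    aEx = fun t => -dslope (fun s => 1 + s - 2 * Real.exp (s - 1)) 1 t := by
  funext t
  rcases eq_or_ne t 1 with rfl | ht
  · rw [aEx_one, dslope_same, (hasDerivAt_aEx_numerator 1).deriv]
    norm_num
  · rw [dslope_of_ne _ ht, aEx_of_ne ht, slope_def_field, ← div_neg]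
    norm_num

lemma continuous_aEx : Continuous aEx := by
  rw [aEx_eq_neg_dslope, ← continuousOn_univ]
  refine ((continuousOn_dslope univ_mem).2 ⟨?_, ?_⟩).neg
  · fun_prop
  · exact (hasDerivAt_aEx_numerator 1).differentiableAt

lemma aEx_pos {t : ℝ} (ht : 0 ≤ t) : 0 < aEx t := by
  rcases lt_trichotomy t 1 with h | rfl | h
  · rw [aEx_of_ne h.ne]
    have he : 2 < Real.exp 1 := by linarith [Real.exp_one_gt_d9]
    have h0 : Real.exp (-1) < 1 / 2 := by
      rw [Real.exp_neg, inv_lt_comm₀ (Real.exp_pos 1) (by norm_num)]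
      norm_num [he]
    have hc := convexOn_exp.2 (mem_univ (-1)) (mem_univ 0) (sub_nonneg.2 h.le) ht (by ring)
    simp only [smul_eq_mul, mul_zero, add_zero, Real.exp_zero, mul_one] at hc
    rw [show (1 - t) * -1 = t - 1 by ring] at hc
    refine div_pos ?_ (by linarith)
    nlinarith [mul_pos (sub_pos.2 h) (sub_pos.2 h0)]
  · rw [aEx_one]
    exact one_pos
  · rw [aEx_of_ne h.ne']
    refine div_pos_of_neg_of_neg ?_ (by linarith)
    linarith [Real.add_one_le_exp (t - 1)]

lemma one_div_aEx_of_one_lt {t : ℝ} (ht : 1 < t) :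
    1 / aEx t = (t - 1) / (2 * Real.exp (t - 1) - 1 - t) := by
  rw [aEx_of_ne ht.ne', one_div_div, ← neg_div_neg_eq]
  congr 1 <;> ring

lemma integrableOn_one_div_aEx : IntegrableOn (fun t => 1 / aEx t) (Ici 0) := by
  rw [integrableOn_Ici_iff_integrableOn_Ioi]
  refine integrable_of_isBigO_exp_neg (b := 1 / 2) (by norm_num)
    (continuousOn_const.div continuous_aEx.continuousOn fun t ht => (aEx_pos ht).ne') ?_
  refine Asymptotics.IsBigO.of_bound (2 * Real.exp (1 / 2)) ?_
  filter_upwards [eventually_ge_atTop 3] with t ht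
  have hq := Real.quadratic_le_exp_of_nonneg (show 0 ≤ t - 1 by linarith)
  have hl := Real.add_one_le_exp ((t - 1) / 2)
  have hD : Real.exp (t - 1) ≤ 2 * Real.exp (t - 1) - 1 - t := by nlinarith
  rw [Real.norm_of_nonneg (one_div_pos.2 (aEx_pos (by linarith))).le,
    Real.norm_of_nonneg (Real.exp_pos _).le, one_div_aEx_of_one_lt (by linarith)]
  calc (t - 1) / (2 * Real.exp (t - 1) - 1 - t) ≤ (t - 1) / Real.exp (t - 1) := by
        gcongr
        linarith
    _ ≤ 2 * Real.exp ((t - 1) / 2) / Real.exp (t - 1) := by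
        gcongr
        linarith
    _ = 2 * Real.exp (1 / 2) * Real.exp (-(1 / 2) * t) := by
        rw [mul_div_assoc, ← Real.exp_sub, mul_assoc, ← Real.exp_add]
        congr 2
        ring

lemma not_integrableOn_one_div_aEx_mul_sq :
    ¬ IntegrableOn (fun t => 1 / (aEx t * (t * Real.exp (-t)) ^ 2)) (Ici 1) := by
  intro h
  have hc : IntegrableOn (fun _ : ℝ => (1 / 4 : ℝ)) (Ici 2) := by
    refine Integrable.mono' (h.mono_set (Ici_subset_Ici.2 one_le_two))
      aestronglyMeasurable_const ?_
    filter_upwards [ae_restrict_mem measurableSet_Ici] with t ht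
    have ht : 2 ≤ t := ht
    have hq := Real.quadratic_le_exp_of_nonneg (show 0 ≤ t - 1 by linarith)
    have ha := aEx_pos (show 0 ≤ t by linarith)
    have hE := Real.exp_pos (t - 1)
    have ha' : aEx t ≤ 2 * Real.exp (t - 1) := by
      nlinarith [aEx_mul_one_sub t]
    have hsq : t ^ 2 ≤ 2 * Real.exp (t - 1) := by nlinarith
    have hexp : Real.exp (t - 1) * Real.exp (t - 1) * Real.exp (-t) ^ 2 ≤ 1 := by
      rw [sq, ← Real.exp_add, ← Real.exp_add, ← Real.exp_add, Real.exp_le_one_iff]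
      linarith
    rw [Real.norm_of_nonneg (by norm_num)]
    refine one_div_le_one_div_of_le (by positivity) ?_
    calc aEx t * (t * Real.exp (-t)) ^ 2 = aEx t * t ^ 2 * Real.exp (-t) ^ 2 := by ring
      _ ≤ 2 * Real.exp (t - 1) * (2 * Real.exp (t - 1)) * Real.exp (-t) ^ 2 := by gcongr
      _ ≤ 4 := by linarith
  rw [integrableOn_const_iff] at hc
  simp at hc

lemma hasDerivAt_mul_exp_neg (t : ℝ) :
    HasDerivAt (fun s => s * Real.exp (-s)) ((1 - t) * Real.exp (-t)) t := by
  refine ((hasDerivAt_id t).mul (hasDerivAt_neg t).exp).congr_deriv ?_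
  simp only [id]
  ring

lemma hasDerivAt_aEx_mul_deriv (t : ℝ) :
    HasDerivAt (fun s => aEx s * ((1 - s) * Real.exp (-s))) (-(t * Real.exp (-t))) t := by
  have h : (fun s => aEx s * ((1 - s) * Real.exp (-s))) =
      fun s => (1 + s - 2 * Real.exp (s - 1)) * Real.exp (-s) := by
    funext s
    rw [← mul_assoc, aEx_mul_one_sub]
  rw [h]
  refine ((hasDerivAt_aEx_numerator t).mul (hasDerivAt_neg t).exp).congr_deriv ?_
  ring

lemma solODE_mul_exp_neg :
    SolODE aEx (fun _ => 1) id (Ici 0) (fun t => t * Real.exp (-t))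
      (fun t => (1 - t) * Real.exp (-t)) :=
  ⟨fun t _ => (hasDerivAt_mul_exp_neg t).hasDerivWithinAt, by fun_prop,
    fun t => -(t * Real.exp (-t)), fun t _ => (hasDerivAt_aEx_mul_deriv t).hasDerivWithinAt,
    by fun_prop, fun t _ => by simp⟩

lemma Convex.eq_of_hasDerivWithinAt_eq_zero {s : Set ℝ} (hs : Convex ℝ s) {f : ℝ → ℝ}
    (hf : ∀ t ∈ s, HasDerivWithinAt f 0 s t) {x y : ℝ} (hx : x ∈ s) (hy : y ∈ s) :
    f x = f y := by
  have h := hs.norm_image_sub_le_of_norm_hasDerivWithin_le (C := 0) hf (by simp) hy hx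
  simpa [sub_eq_zero] using h

/-- Abel's identity: the weighted Wronskian of two solutions of `(a y')' + β y = 0` is constant. -/
lemma SolODE.wronskian_eq {a β : ℝ → ℝ} {I : Set ℝ} (hI : Convex ℝ I) {u u' v v' : ℝ → ℝ}
    (hu : SolODE a β id I u u') (hv : SolODE a β id I v v') {x y : ℝ} (hx : x ∈ I) (hy : y ∈ I) :
    a x * (u' x * v x - u x * v' x) = a y * (u' y * v y - u y * v' y) := by
  obtain ⟨hu₁, -, p, hp, -, hpu⟩ := hu
  obtain ⟨hv₁, -, q, hq, -, hqv⟩ := hv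
  have h := hI.eq_of_hasDerivWithinAt_eq_zero
    (f := fun t => a t * u' t * v t - u t * (a t * v' t)) (fun t ht => by
      refine (((hp t ht).mul (hv₁ t ht)).sub ((hu₁ t ht).mul (hq t ht))).congr_deriv ?_
      have h₁ := hpu t ht
      have h₂ := hqv t ht
      simp only [id] at h₁ h₂
      linear_combination v t * h₁ - u t * h₂) hx hy
  linear_combination h

/-- A solution that is positive on `(0, ∞)` and vanishes at `0` makes the equation disconjugate
on `[0, ∞)`. -/
lemma disconjugate_Ici_of_pos {a β u u' : ℝ → ℝ} (ha : ∀ t ∈ Ici (0 : ℝ), 0 < a t)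
    (hu : SolODE a β id (Ici 0) u u') (hu₀ : u 0 = 0) (hpos : ∀ t ∈ Ioi (0 : ℝ), 0 < u t) :
    Disconjugate a β (Ici 0) := by
  intro y y' hy ⟨t₀, ht₀, hyt₀⟩
  have hderiv : ∀ t ∈ Ioi (0 : ℝ),
      HasDerivAt (fun s => y s / u s) ((y' t * u t - y t * u' t) / u t ^ 2) t := fun t ht =>
    ((hy.1 t (Ioi_subset_Ici_self ht)).hasDerivAt (Ici_mem_nhds ht)).div
      ((hu.1 t (Ioi_subset_Ici_self ht)).hasDerivAt (Ici_mem_nhds ht)) (hpos t ht).ne'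
  have key : ∀ t₁ ∈ Ici (0 : ℝ), ∀ t₂, t₁ < t₂ → y t₁ = 0 → y t₂ = 0 → False := by
    intro t₁ ht₁ t₂ hlt h₁ h₂
    have ht₂ : 0 < t₂ := lt_of_le_of_lt ht₁ hlt
    have hW : ∃ c ∈ Ici (0 : ℝ), y' c * u c - y c * u' c = 0 := by
      rcases eq_or_lt_of_le (show 0 ≤ t₁ from ht₁) with rfl | hpos₁
      · exact ⟨0, ht₁, by rw [h₁, hu₀]; ring⟩
      · obtain ⟨c, hc, hc0⟩ := exists_hasDerivAt_eq_zero hlt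
          (fun t ht => (hderiv t (hpos₁.trans_le ht.1)).continuousAt.continuousWithinAt)
          (by rw [h₁, h₂, zero_div, zero_div]) (fun t ht => hderiv t (hpos₁.trans ht.1))
        have hc_pos : 0 < c := hpos₁.trans hc.1
        exact ⟨c, hc_pos.le, (div_eq_zero_iff.1 hc0).resolve_right
          (pow_ne_zero 2 (hpos c hc_pos).ne')⟩
    obtain ⟨c, hc, hc0⟩ := hW
    have hW0 : ∀ t ∈ Ici (0 : ℝ), y' t * u t - y t * u' t = 0 := by
      intro t ht
      have h := hy.wronskian_eq (convex_Ici 0) hu ht hc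
      rw [hc0, mul_zero] at h
      exact (mul_eq_zero.1 h).resolve_left (ha t ht).ne'
    have hy0 : ∀ t ∈ Ioi (0 : ℝ), y t = 0 := by
      intro t ht
      have h := (convex_Ioi (0 : ℝ)).eq_of_hasDerivWithinAt_eq_zero
        (f := fun s => y s / u s) (fun s hs => by
          have hd := hderiv s hs
          rw [hW0 s (Ioi_subset_Ici_self hs), zero_div] at hd
          exact hd.hasDerivWithinAt) ht ht₂
      simp only [h₂, zero_div] at h
      exact (div_eq_zero_iff.1 h).resolve_right (hpos t ht).ne'
    rcases eq_or_lt_of_le (show 0 ≤ t₀ from ht₀) with rfl | hpos₀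
    · have hlim : Tendsto y (𝓝[>] 0) (𝓝 (y 0)) :=
        (hy.1 0 ht₀).continuousWithinAt.mono Ioi_subset_Ici_self
      have hlim0 : Tendsto y (𝓝[>] 0) (𝓝 0) :=
        tendsto_const_nhds.congr' (eventually_mem_nhdsWithin.mono fun t ht => (hy0 t ht).symm)
      exact hyt₀ (tendsto_nhds_unique hlim hlim0)
    · exact hyt₀ (hy0 t₀ hpos₀)
  intro t₁ ht₁ t₂ ht₂ h₁ h₂
  rcases lt_trichotomy t₁ t₂ with h | h | h
  · exact (key t₁ ht₁ t₂ h h₁ h₂).elim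
  · exact h
  · exact (key t₂ ht₂ t₁ h h₂ h₁).elim

/-- Example 1: `a` is continuous and positive on `[0,∞)` with `∫₀^∞ dt/a(t) < ∞`;
`y₀(t) = t e^{-t}` solves `(a y')' + y = 0`, is positive on `(0,∞)`, satisfies
`∫₁^∞ dt/(a y₀²) = ∞` (so it is principal), and the equation is disconjugate on `[0,∞)`. -/
theorem example_one :
    ContinuousOn aEx (Ici 0) ∧ (∀ t ∈ Ici (0:ℝ), 0 < aEx t) ∧
    IntegrableOn (fun t => 1 / aEx t) (Ici 0) ∧
    (∃ y₀' : ℝ → ℝ, SolODE aEx (fun _ => 1) id (Ici 0) (fun t => t * Real.exp (-t)) y₀') ∧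
    (∀ t ∈ Ioi (0:ℝ), 0 < t * Real.exp (-t)) ∧
    ¬ IntegrableOn (fun t => 1 / (aEx t * (t * Real.exp (-t)) ^ 2)) (Ici 1) ∧
    Disconjugate aEx (fun _ => 1) (Ici 0) := by
  have hpos : ∀ t ∈ Ioi (0:ℝ), 0 < t * Real.exp (-t) := fun t ht => mul_pos ht (Real.exp_pos _)
  exact ⟨continuous_aEx.continuousOn, fun t ht => aEx_pos ht, integrableOn_one_div_aEx,
    ⟨_, solODE_mul_exp_neg⟩, hpos, not_integrableOn_one_div_aEx_mul_sq,
    disconjugate_Ici_of_pos (fun t ht => aEx_pos ht) solODE_mul_exp_neg (zero_mul _) hpos⟩
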